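/- arXiv:2207.01408 — 5 statements merged into one kernel-verified Lean document; each statement's English description precedes it below -/
import Mathlib

section
/- Along any solution of Gustafsson's equations on the two-torus, the Hamiltonian H is conserved: if t ↦ (x(t), y(t), A(t), B(t)) is a differentiable curve satisfying the system, then t ↦ H(x(t), y(t), A(t), B(t)) is constant. -/
/-- Gustafsson's equations for a single vortex on the two-torus `ℝ²/(aℤ ⊕ bℤ)`:
the curves `x, y, A, B : ℝ → ℝ` (vortex position and harmonic coefficients), with
derivative functions `x', y', A', B'`, satisfy
`λ²ẋ = ½∂R/∂y + b_yA − a_yB`, `λ²ẏ = −½∂R/∂x − bₓA + aₓB`,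
`b_yȦ − a_yḂ − ẏ = bₓA − aₓB`, `−bₓȦ + aₓḂ + ẋ = b_yA − a_yB`. -/
def GustafssonEqs (a b : ℝ × ℝ) (lam R : ℝ × ℝ → ℝ)
    (x y A B x' y' A' B' : ℝ → ℝ) : Prop :=
  (∀ t, (lam (x t, y t)) ^ 2 * x' t
      = (1 / 2) * fderiv ℝ R (x t, y t) (0, 1) + b.2 * A t - a.2 * B t) ∧
  (∀ t, (lam (x t, y t)) ^ 2 * y' t
      = -((1 / 2) * fderiv ℝ R (x t, y t) (1, 0)) - b.1 * A t + a.1 * B t) ∧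
  (∀ t, b.2 * A' t - a.2 * B' t - y' t = b.1 * A t - a.1 * B t) ∧
  (∀ t, -(b.1 * A' t) + a.1 * B' t + x' t = b.2 * A t - a.2 * B t)

/-- The Hamiltonian of Gustafsson's equations on the two-torus:
`H(x,y,A,B) = R(x,y)/2 + ½(‖b‖²A² − 2⟨a,b⟩AB + ‖a‖²B²)`. -/
noncomputable def gustafssonHam (a b : ℝ × ℝ) (R : ℝ × ℝ → ℝ)
    (x y A B : ℝ) : ℝ :=
  R (x, y) / 2 +
    (1 / 2) * ((b.1 ^ 2 + b.2 ^ 2) * A ^ 2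
        - 2 * (a.1 * b.1 + a.2 * b.2) * A * B + (a.1 ^ 2 + a.2 ^ 2) * B ^ 2)

/-- Along any (everywhere-differentiable) solution of Gustafsson's equations on the
two-torus, the Hamiltonian `H` is conserved. -/
theorem gustafsson_hamiltonian_conserved (a b : ℝ × ℝ)
    (hcov : a.1 * b.2 - a.2 * b.1 = 1)
    (lam R : ℝ × ℝ → ℝ)
    (hlam : ContDiff ℝ (⊤ : ℕ∞) lam) (hlam_pos : ∀ p, 0 < lam p)
    (hlam_a : ∀ p : ℝ × ℝ, lam (p + a) = lam p)
    (hlam_b : ∀ p : ℝ × ℝ, lam (p + b) = lam p)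
    (hR : ContDiff ℝ (⊤ : ℕ∞) R)
    (hRa : ∀ p : ℝ × ℝ, R (p + a) = R p)
    (hRb : ∀ p : ℝ × ℝ, R (p + b) = R p)
    (x y A B x' y' A' B' : ℝ → ℝ)
    (hx : ∀ t, HasDerivAt x (x' t) t) (hy : ∀ t, HasDerivAt y (y' t) t)
    (hA : ∀ t, HasDerivAt A (A' t) t) (hB : ∀ t, HasDerivAt B (B' t) t)
    (heqs : GustafssonEqs a b lam R x y A B x' y' A' B') :
    ∀ t s : ℝ,
      gustafssonHam a b R (x t) (y t) (A t) (B t)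
        = gustafssonHam a b R (x s) (y s) (A s) (B s) := by
  obtain ⟨e1, e2, e3, e4⟩ := heqs
  have hRd : Differentiable ℝ R := hR.differentiable (by simp)
  have key : ∀ t, HasDerivAt
      (fun t => gustafssonHam a b R (x t) (y t) (A t) (B t)) 0 t := by
    intro t
    have h1 : HasDerivAt (fun t => R (x t, y t))
        (fderiv ℝ R (x t, y t) (x' t, y' t)) t :=
      (hRd (x t, y t)).hasFDerivAt.comp_hasDerivAt t ((hx t).prodMk (hy t))
    have h2 : fderiv ℝ R (x t, y t) (x' t, y' t)
        = x' t * fderiv ℝ R (x t, y t) (1, 0) + y' t * fderiv ℝ R (x t, y t) (0, 1) := by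
      have h3 : ((x' t, y' t) : ℝ × ℝ) = x' t • ((1, 0) : ℝ × ℝ) + y' t • ((0, 1) : ℝ × ℝ) := by
        simp
      rw [h3, map_add, map_smul, map_smul, smul_eq_mul, smul_eq_mul]
    rw [h2] at h1
    have h4 := (h1.div_const 2).add
      ((((((hA t).pow 2).const_mul (b.1 ^ 2 + b.2 ^ 2)).sub
        (((hA t).const_mul (2 * (a.1 * b.1 + a.2 * b.2))).mul (hB t))).add
        (((hB t).pow 2).const_mul (a.1 ^ 2 + a.2 ^ 2))).const_mul (1 / 2))
    refine HasDerivAt.congr_deriv (f := fun t => gustafssonHam a b R (x t) (y t) (A t) (B t)) h4 ?_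
    norm_num
    linear_combination (-(y' t)) * e1 t + x' t * e2 t
      + (b.2 * A t - a.2 * B t) * e3 t + (-(b.1 * A t) + a.1 * B t) * e4 t
  exact is_const_of_deriv_eq_zero (fun t => (key t).differentiableAt) (fun t => (key t).deriv)
end

section
/- Let R : ℝ² → ℝ be continuously differentiable and periodic with respect to the lattice generated by a = (aₓ, a_y) and b = (bₓ, b_y), where aₓb_y − a_ybₓ = 1, and let A, B ∈ ℝ. Then the vortex velocity vanishes at every position, i.e. ½∂R/∂y(x,y) + b_yA − a_yB = 0 and ½∂R/∂x(x,y) + bₓA − aₓB = 0 for all (x,y) ∈ ℝ², if and only if R is constant and A = B = 0. -/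
/-- Two-torus instance of the steady-vortex theorem: for `R : ℝ² → ℝ` C¹ and
periodic with respect to the lattice generated by `a, b` with
`aₓb_y − a_ybₓ = 1`, and `A, B ∈ ℝ`, the vortex velocity
`U = −∗d(R/2) + Aα + Bβ` vanishes at every position, i.e.
`½∂R/∂y + b_yA − a_yB = 0` and `½∂R/∂x + bₓA − aₓB = 0` everywhere,
if and only if `R` is constant and `A = B = 0`. -/
theorem torus_steady_vortex_iff (a b : ℝ × ℝ)
    (hcov : a.1 * b.2 - a.2 * b.1 = 1)
    (R : ℝ × ℝ → ℝ) (hR : ContDiff ℝ 1 R)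
    (hRa : ∀ p : ℝ × ℝ, R (p + a) = R p)
    (hRb : ∀ p : ℝ × ℝ, R (p + b) = R p)
    (A B : ℝ) :
    (∀ p : ℝ × ℝ,
        (1 / 2) * fderiv ℝ R p (0, 1) + b.2 * A - a.2 * B = 0 ∧
        (1 / 2) * fderiv ℝ R p (1, 0) + b.1 * A - a.1 * B = 0) ↔
    ((∀ p q : ℝ × ℝ, R p = R q) ∧ A = 0 ∧ B = 0) := by
  constructor
  · intro h
    have hd : Differentiable ℝ R := hR.differentiable (by norm_num)
    set c : ℝ := -2 * (b.1 * A - a.1 * B) with hc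
    set d : ℝ := -2 * (b.2 * A - a.2 * B) with hdd
    let L : ℝ × ℝ →L[ℝ] ℝ :=
      c • ContinuousLinearMap.fst ℝ ℝ ℝ + d • ContinuousLinearMap.snd ℝ ℝ ℝ
    have hL : ∀ v : ℝ × ℝ, L v = c * v.1 + d * v.2 := fun v => by simp [L]
    have hf : ∀ p, fderiv ℝ R p = L := by
      intro p
      obtain ⟨h1, h2⟩ := h p
      ext
      · simp [hL]
        linarith
      · simp [hL]
        linarith
    have hconst : ∀ p q : ℝ × ℝ, R p - L p = R q - L q := by
      have hdiff : Differentiable ℝ (fun p => R p - L p) := hd.sub L.differentiable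
      refine is_const_of_fderiv_eq_zero (𝕜 := ℝ) hdiff ?_
      intro p
      have := ((hd p).hasFDerivAt.sub (L.hasFDerivAt (x := p))).fderiv
      rw [hf p, sub_self] at this
      exact this
    have ha : c * a.1 + d * a.2 = 0 := by
      have h1 := hconst (0 + a) 0
      rw [hRa 0, map_add, hL a] at h1
      linarith
    have hb : c * b.1 + d * b.2 = 0 := by
      have h1 := hconst (0 + b) 0
      rw [hRb 0, map_add, hL b] at h1
      linarith
    have c0 : c = 0 := by linear_combination b.2 * ha - a.2 * hb - c * hcov
    have d0 : d = 0 := by linear_combination a.1 * hb - b.1 * ha - d * hcov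
    have e1 : b.1 * A - a.1 * B = 0 := by linarith
    have e2 : b.2 * A - a.2 * B = 0 := by linarith
    refine ⟨fun p q => ?_, ?_, ?_⟩
    · have := hconst p q
      rw [hL, hL, c0, d0] at this
      linarith
    · linear_combination a.1 * e2 - a.2 * e1 - A * hcov
    · linear_combination b.1 * e2 - b.2 * e1 - B * hcov
  · rintro ⟨h, rfl, rfl⟩ p
    have : R = fun _ => R 0 := funext fun q => h q 0
    rw [this]
    simp
end

section
/- Suppose (x₀, y₀) is a strict local minimum of the Robin function R. Then the equilibrium (x₀, y₀, 0, 0) of Gustafsson's equations on the two-torus is Lyapunov stable: for every ε > 0 there exists δ > 0 such that every differentiable solution t ↦ (x(t), y(t), A(t), B(t)) of the system, defined for t in an interval containing 0, whose initial value lies within distance δ of (x₀, y₀, 0, 0), remains within distance ε of (x₀, y₀, 0, 0) for all times in its interval of definition. -/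
/-- Gustafsson's equations for a single vortex on the two-torus `ℝ²/(aℤ ⊕ bℤ)`,
holding for all times `t` in a set `I`: the curves `x, y, A, B : ℝ → ℝ` with
derivative functions `x', y', A', B'` satisfy
`λ²ẋ = ½∂R/∂y + b_yA − a_yB`, `λ²ẏ = −½∂R/∂x − bₓA + aₓB`,
`b_yȦ − a_yḂ − ẏ = bₓA − aₓB`, `−bₓȦ + aₓḂ + ẋ = b_yA − a_yB`. -/
def GustafssonEqsOn (I : Set ℝ) (a b : ℝ × ℝ) (lam R : ℝ × ℝ → ℝ)
    (x y A B x' y' A' B' : ℝ → ℝ) : Prop :=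
  (∀ t ∈ I, (lam (x t, y t)) ^ 2 * x' t
      = (1 / 2) * fderiv ℝ R (x t, y t) (0, 1) + b.2 * A t - a.2 * B t) ∧
  (∀ t ∈ I, (lam (x t, y t)) ^ 2 * y' t
      = -((1 / 2) * fderiv ℝ R (x t, y t) (1, 0)) - b.1 * A t + a.1 * B t) ∧
  (∀ t ∈ I, b.2 * A' t - a.2 * B' t - y' t = b.1 * A t - a.1 * B t) ∧
  (∀ t ∈ I, -(b.1 * A' t) + a.1 * B' t + x' t = b.2 * A t - a.2 * B t)

/-- If `(x₀, y₀)` is a strict local minimum of the Robin function `R`, then the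
equilibrium `(x₀, y₀, 0, 0)` of Gustafsson's equations on the two-torus is
Lyapunov stable: for every `ε > 0` there is `δ > 0` such that every differentiable
solution defined on an interval `I ∋ 0` whose initial value is within `δ` of
`(x₀, y₀, 0, 0)` stays within `ε` of `(x₀, y₀, 0, 0)` for all `t ∈ I`. -/
theorem gustafsson_strict_local_min_stable (a b : ℝ × ℝ)
    (hcov : a.1 * b.2 - a.2 * b.1 = 1)
    (lam R : ℝ × ℝ → ℝ)
    (hlam : ContDiff ℝ (⊤ : ℕ∞) lam) (hlam_pos : ∀ p, 0 < lam p)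
    (hlam_a : ∀ p : ℝ × ℝ, lam (p + a) = lam p)
    (hlam_b : ∀ p : ℝ × ℝ, lam (p + b) = lam p)
    (hR : ContDiff ℝ (⊤ : ℕ∞) R)
    (hRa : ∀ p : ℝ × ℝ, R (p + a) = R p)
    (hRb : ∀ p : ℝ × ℝ, R (p + b) = R p)
    (x0 y0 : ℝ)
    (hmin : ∃ U ∈ nhds ((x0, y0) : ℝ × ℝ),
      ∀ p ∈ U, p ≠ (x0, y0) → R (x0, y0) < R p) :
    ∀ ε > (0 : ℝ), ∃ δ > (0 : ℝ),
      ∀ (I : Set ℝ), I.OrdConnected → (0 : ℝ) ∈ I →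
        ∀ x y A B x' y' A' B' : ℝ → ℝ,
          (∀ t ∈ I, HasDerivWithinAt x (x' t) I t) →
          (∀ t ∈ I, HasDerivWithinAt y (y' t) I t) →
          (∀ t ∈ I, HasDerivWithinAt A (A' t) I t) →
          (∀ t ∈ I, HasDerivWithinAt B (B' t) I t) →
          GustafssonEqsOn I a b lam R x y A B x' y' A' B' →
          dist ((x 0, y 0, A 0, B 0) : ℝ × ℝ × ℝ × ℝ) (x0, y0, 0, 0) < δ →
          ∀ t ∈ I,
            dist ((x t, y t, A t, B t) : ℝ × ℝ × ℝ × ℝ) (x0, y0, 0, 0) < ε := by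
  intro ε hε
  obtain ⟨U, hU, hUmin⟩ := hmin
  obtain ⟨r0, hr0, hr0U⟩ := Metric.nhds_basis_closedBall.mem_iff.mp hU
  set z0 : ℝ × ℝ × ℝ × ℝ := (x0, y0, 0, 0) with hz0
  obtain ⟨r, hr, hrr0, hrε⟩ : ∃ r : ℝ, 0 < r ∧ r ≤ r0 ∧ r < ε :=
    ⟨min r0 (ε / 2), lt_min hr0 (by linarith), min_le_left _ _,
      lt_of_le_of_lt (min_le_right _ _) (by linarith)⟩
  let H : ℝ × ℝ × ℝ × ℝ → ℝ := fun z => R (z.1, z.2.1) / 2 +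
    ((b.2 * z.2.2.1 - a.2 * z.2.2.2) ^ 2 + (-(b.1 * z.2.2.1) + a.1 * z.2.2.2) ^ 2) / 2
  have hRc : Continuous R := hR.continuous
  have hHc : Continuous H := by
    dsimp only [H]
    fun_prop
  have hHmin : ∀ z ∈ Metric.sphere z0 r, H z0 < H z := by
    rintro ⟨p, q, u, v⟩ hz
    have hd : dist ((p, q, u, v) : ℝ × ℝ × ℝ × ℝ) z0 = r := hz
    have hpU : ((p, q) : ℝ × ℝ) ∈ U := by
      apply hr0U
      rw [Metric.mem_closedBall]
      refine le_trans ?_ hrr0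
      rw [← hd, hz0]
      simp only [Prod.dist_eq]
      exact max_le_max le_rfl (le_max_left _ _)
    have e0 : H z0 = R (x0, y0) / 2 := by simp [H, hz0]
    have e1 : H (p, q, u, v) = R (p, q) / 2 +
      ((b.2 * u - a.2 * v) ^ 2 + (-(b.1 * u) + a.1 * v) ^ 2) / 2 := rfl
    rw [e0, e1]
    by_cases hpq : ((p, q) : ℝ × ℝ) = (x0, y0)
    · rw [hpq]
      have hpos : 0 < (b.2 * u - a.2 * v) ^ 2 + (-(b.1 * u) + a.1 * v) ^ 2 := by
        by_contra hcon
        have h1 : b.2 * u - a.2 * v = 0 := by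
          nlinarith [sq_nonneg (b.2 * u - a.2 * v), sq_nonneg (-(b.1 * u) + a.1 * v)]
        have h2 : -(b.1 * u) + a.1 * v = 0 := by
          nlinarith [sq_nonneg (b.2 * u - a.2 * v), sq_nonneg (-(b.1 * u) + a.1 * v)]
        have hu : u = 0 := by linear_combination a.1 * h1 + a.2 * h2 - u * hcov
        have hv : v = 0 := by linear_combination b.1 * h1 + b.2 * h2 - v * hcov
        obtain ⟨h3, h4⟩ := Prod.mk.inj hpq
        rw [hz0, hu, hv, h3, h4, dist_self] at hd
        linarith
      linarith
    · have := hUmin _ hpU hpq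
      nlinarith [sq_nonneg (b.2 * u - a.2 * v), sq_nonneg (-(b.1 * u) + a.1 * v)]
  obtain ⟨m, hm0, hm⟩ : ∃ m, H z0 < m ∧ ∀ z ∈ Metric.sphere z0 r, m ≤ H z := by
    rcases (Metric.sphere z0 r).eq_empty_or_nonempty with he | hne
    · exact ⟨H z0 + 1, by linarith, by simp [he]⟩
    · obtain ⟨z, hz, hzm⟩ := (isCompact_sphere z0 r).exists_isMinOn hne hHc.continuousOn
      exact ⟨H z, hHmin z hz, fun w hw => hzm hw⟩
  obtain ⟨d, hd, hdm⟩ := Metric.eventually_nhds_iff.mp (hHc.continuousAt.eventually_lt_const hm0)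
  refine ⟨min d r, lt_min hd hr, ?_⟩
  intro I hI h0 x y A B x' y' A' B' hx hy hA hB hG hinit t ht
  obtain ⟨g1, g2, g3, g4⟩ := hG
  have hconv : Convex ℝ I := hI.convex
  have hder : ∀ s ∈ I, HasDerivWithinAt (fun s => H (x s, y s, A s, B s)) 0 I s := by
    intro s hs
    have hRd : HasFDerivAt R (fderiv ℝ R (x s, y s)) (x s, y s) :=
      ((hR.differentiable (by simp)) _).hasFDerivAt
    have hcomp := hRd.comp_hasDerivWithinAt s ((hx s hs).prodMk (hy s hs))
    have e : fderiv ℝ R (x s, y s) (x' s, y' s) =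
        x' s * fderiv ℝ R (x s, y s) (1, 0) + y' s * fderiv ℝ R (x s, y s) (0, 1) := by
      rw [← smul_eq_mul, ← smul_eq_mul, ← map_smul, ← map_smul, ← map_add]
      simp
    rw [e] at hcomp
    have h1 := (((hA s hs).const_mul b.2).sub ((hB s hs).const_mul a.2)).pow 2
    have h2 := (((hA s hs).const_mul b.1).neg.add ((hB s hs).const_mul a.1)).pow 2
    have h3 := (hcomp.div_const 2).add ((h1.add h2).div_const 2)
    refine h3.congr_deriv ?_
    have k1 := g1 s hs
    have k2 := g2 s hs
    have k3 := g3 s hs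
    have k4 := g4 s hs
    simp only [Pi.add_apply, Pi.sub_apply, Pi.neg_apply]
    norm_num
    linear_combination (-y' s) * k1 + x' s * k2 + (b.2 * A s - a.2 * B s) * k3
      + (-(b.1 * A s) + a.1 * B s) * k4
  have hconst : ∀ s ∈ I, H (x s, y s, A s, B s) = H (x 0, y 0, A 0, B 0) := by
    intro s hs
    have := hconv.norm_image_sub_le_of_norm_hasDerivWithin_le (C := 0) hder
      (fun _ _ => by simp) h0 hs
    rw [zero_mul] at this
    exact sub_eq_zero.mp (norm_le_zero_iff.mp this)
  by_contra hcon
  rw [not_lt] at hcon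
  have hcont : ContinuousOn (fun s => dist ((x s, y s, A s, B s) : ℝ × ℝ × ℝ × ℝ) z0) I := by
    have c1 : ContinuousOn x I := fun s hs => (hx s hs).continuousWithinAt
    have c2 : ContinuousOn y I := fun s hs => (hy s hs).continuousWithinAt
    have c3 : ContinuousOn A I := fun s hs => (hA s hs).continuousWithinAt
    have c4 : ContinuousOn B I := fun s hs => (hB s hs).continuousWithinAt
    fun_prop
  obtain ⟨s, hs, hsr⟩ := hI.isPreconnected.intermediate_value h0 ht hcont
    (show r ∈ Set.Icc _ _ from ⟨(hinit.trans_le (min_le_right _ _)).le, hrε.le.trans hcon⟩)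
  have k1 := hm _ (show (x s, y s, A s, B s) ∈ Metric.sphere z0 r from hsr)
  have k2 := hdm (hinit.trans_le (min_le_left _ _))
  rw [hconst s hs] at k1
  linarith
end

section
/- On a flat torus (λ ≡ 1 and R constant), Gustafsson's equations reduce to ẋ = b_yA − a_yB, ẏ = −bₓA + aₓB, Ȧ = 0, Ḃ = 0. Consequently, every solution has A and B constant and the vortex moves along a straight line: for any (x₀, y₀) ∈ ℝ² and constants A₀, B₀ ∈ ℝ, the curve t ↦ (x₀ + t(b_yA₀ − a_yB₀), y₀ + t(−bₓA₀ + aₓB₀), A₀, B₀) is a solution of the system. -/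
/-- On a flat torus (`λ ≡ 1`, `R ≡ c` constant), Gustafsson's equations reduce to
`ẋ = b_yA − a_yB`, `ẏ = −bₓA + aₓB`, `Ȧ = 0`, `Ḃ = 0`; consequently every solution
has `A` and `B` constant, and for any `(x₀, y₀)` and constants `A₀, B₀` the
straight-line curve
`t ↦ (x₀ + t(b_yA₀ − a_yB₀), y₀ + t(−bₓA₀ + aₓB₀), A₀, B₀)` is a solution. -/
theorem gustafsson_flat_torus (a b : ℝ × ℝ)
    (hcov : a.1 * b.2 - a.2 * b.1 = 1) (c : ℝ) :
    (∀ x y A B x' y' A' B' : ℝ → ℝ,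
      (∀ t, HasDerivAt x (x' t) t) → (∀ t, HasDerivAt y (y' t) t) →
      (∀ t, HasDerivAt A (A' t) t) → (∀ t, HasDerivAt B (B' t) t) →
      GustafssonEqs a b (fun _ => 1) (fun _ => c) x y A B x' y' A' B' →
        ((∀ t, x' t = b.2 * A t - a.2 * B t ∧ y' t = -(b.1 * A t) + a.1 * B t ∧
            A' t = 0 ∧ B' t = 0) ∧
         ∀ t s : ℝ, A t = A s ∧ B t = B s)) ∧
    (∀ x0 y0 A0 B0 : ℝ,
      (∀ t : ℝ, HasDerivAt (fun t : ℝ => x0 + t * (b.2 * A0 - a.2 * B0))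
        (b.2 * A0 - a.2 * B0) t) ∧
      (∀ t : ℝ, HasDerivAt (fun t : ℝ => y0 + t * (-(b.1 * A0) + a.1 * B0))
        (-(b.1 * A0) + a.1 * B0) t) ∧
      GustafssonEqs a b (fun _ => 1) (fun _ => c)
        (fun t => x0 + t * (b.2 * A0 - a.2 * B0))
        (fun t => y0 + t * (-(b.1 * A0) + a.1 * B0))
        (fun _ => A0) (fun _ => B0)
        (fun _ => b.2 * A0 - a.2 * B0) (fun _ => -(b.1 * A0) + a.1 * B0)
        (fun _ => 0) (fun _ => 0)) := by
  constructor
  · intro x y A B x' y' A' B' hx hy hA hB h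
    obtain ⟨h1, h2, h3, h4⟩ := h
    have key : ∀ t, x' t = b.2 * A t - a.2 * B t ∧ y' t = -(b.1 * A t) + a.1 * B t ∧
        A' t = 0 ∧ B' t = 0 := by
      intro t
      have e1 := h1 t
      have e2 := h2 t
      have e3 := h3 t
      have e4 := h4 t
      simp at e1 e2
      have f3 : b.2 * A' t - a.2 * B' t = 0 := by linarith
      have f4 : -(b.1 * A' t) + a.1 * B' t = 0 := by linarith
      refine ⟨by linarith, by linarith, ?_, ?_⟩
      · linear_combination a.1 * f3 + a.2 * f4 - A' t * hcov
      · linear_combination b.1 * f3 + b.2 * f4 - B' t * hcov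
    refine ⟨key, fun t s => ⟨?_, ?_⟩⟩
    · exact is_const_of_deriv_eq_zero (fun t => (hA t).differentiableAt)
        (fun t => by rw [(hA t).deriv, (key t).2.2.1]) t s
    · exact is_const_of_deriv_eq_zero (fun t => (hB t).differentiableAt)
        (fun t => by rw [(hB t).deriv, (key t).2.2.2]) t s
  · intro x0 y0 A0 B0
    have hd : ∀ p v t : ℝ, HasDerivAt (fun t : ℝ => p + t * v) v t := by
      intro p v t
      simpa using ((hasDerivAt_id t).mul_const v).const_add p
    refine ⟨hd _ _, hd _ _, ?_, ?_, ?_, ?_⟩ <;> intro t <;> simp <;> ring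
end

section
/- Let a, b ∈ ℝ² with aₓb_y − a_ybₓ = 1, let λ : ℝ² → ℝ be positive, and let M(x,y) be the antisymmetric 4×4 matrix with M₁₂ = λ(x,y)² − 1, M₁₃ = b_y, M₁₄ = −a_y, M₂₃ = −bₓ, M₂₄ = aₓ, M₃₄ = −1. A differentiable curve t ↦ z(t) = (x(t), y(t), A(t), B(t)) satisfies Gustafsson's equations on the two-torus if and only if it satisfies the Hamiltonian equation Mᵀ(x(t),y(t)) · ż(t) = ∇H(z(t)), where ∇H = (½∂R/∂x, ½∂R/∂y, ‖b‖²A − ⟨a,b⟩B, ‖a‖²B − ⟨a,b⟩A). -/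
/-- The matrix of the symplectic form `Ω = λ²dx∧dy − (dA − β)∧(dB + α)` of
Gustafsson's equations on the two-torus, in coordinates `(x, y, A, B)`. -/
def gustafssonSymplecticMatrix (a b : ℝ × ℝ) (l : ℝ) : Matrix (Fin 4) (Fin 4) ℝ :=
  !![0,            l ^ 2 - 1, b.2,  -a.2;
     -(l ^ 2 - 1), 0,         -b.1, a.1;
     -b.2,         b.1,       0,    -1;
     a.2,          -a.1,      1,    0]

/-- A differentiable curve `t ↦ z(t) = (x(t), y(t), A(t), B(t))` satisfies
Gustafsson's equations on the two-torus if and only if it satisfies the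
Hamiltonian equation `Mᵀ(x,y)·ż = ∇H(z)`, where `M` is the matrix of the
symplectic form `Ω` and
`∇H = (½∂R/∂x, ½∂R/∂y, ‖b‖²A − ⟨a,b⟩B, ‖a‖²B − ⟨a,b⟩A)`. -/
theorem gustafsson_eqs_iff_hamiltonian (a b : ℝ × ℝ)
    (hcov : a.1 * b.2 - a.2 * b.1 = 1)
    (lam R : ℝ × ℝ → ℝ) (hlam_pos : ∀ p, 0 < lam p)
    (x y A B x' y' A' B' : ℝ → ℝ)
    (hx : ∀ t, HasDerivAt x (x' t) t) (hy : ∀ t, HasDerivAt y (y' t) t)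
    (hA : ∀ t, HasDerivAt A (A' t) t) (hB : ∀ t, HasDerivAt B (B' t) t) :
    GustafssonEqs a b lam R x y A B x' y' A' B' ↔
      ∀ t : ℝ,
        (gustafssonSymplecticMatrix a b (lam (x t, y t))).transpose.mulVec
            ![x' t, y' t, A' t, B' t]
          = ![(1 / 2) * fderiv ℝ R (x t, y t) (1, 0),
              (1 / 2) * fderiv ℝ R (x t, y t) (0, 1),
              (b.1 ^ 2 + b.2 ^ 2) * A t - (a.1 * b.1 + a.2 * b.2) * B t,
              (a.1 ^ 2 + a.2 ^ 2) * B t - (a.1 * b.1 + a.2 * b.2) * A t] := by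
  have key : ∀ t : ℝ,
      ((gustafssonSymplecticMatrix a b (lam (x t, y t))).transpose.mulVec
            ![x' t, y' t, A' t, B' t]
          = ![(1 / 2) * fderiv ℝ R (x t, y t) (1, 0),
              (1 / 2) * fderiv ℝ R (x t, y t) (0, 1),
              (b.1 ^ 2 + b.2 ^ 2) * A t - (a.1 * b.1 + a.2 * b.2) * B t,
              (a.1 ^ 2 + a.2 ^ 2) * B t - (a.1 * b.1 + a.2 * b.2) * A t]) ↔
      (-((lam (x t, y t)) ^ 2 - 1) * y' t - b.2 * A' t + a.2 * B' t
          = (1 / 2) * fderiv ℝ R (x t, y t) (1, 0) ∧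
        ((lam (x t, y t)) ^ 2 - 1) * x' t + b.1 * A' t - a.1 * B' t
          = (1 / 2) * fderiv ℝ R (x t, y t) (0, 1) ∧
        b.2 * x' t - b.1 * y' t + B' t
          = (b.1 ^ 2 + b.2 ^ 2) * A t - (a.1 * b.1 + a.2 * b.2) * B t ∧
        -a.2 * x' t + a.1 * y' t - A' t
          = (a.1 ^ 2 + a.2 ^ 2) * B t - (a.1 * b.1 + a.2 * b.2) * A t) := by
    intro t
    generalize fderiv ℝ R (x t, y t) (1, 0) = p
    generalize fderiv ℝ R (x t, y t) (0, 1) = q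
    generalize lam (x t, y t) = l
    rw [funext_iff, Fin.forall_fin_succ, Fin.forall_fin_succ, Fin.forall_fin_succ,
      Fin.forall_fin_succ]
    simp only [gustafssonSymplecticMatrix, Matrix.mulVec, dotProduct, Fin.sum_univ_four,
      Matrix.transpose_apply]
    simp
    ring_nf
  constructor
  · rintro ⟨g1, g2, g3, g4⟩ t
    rw [key]
    refine ⟨?_, ?_, ?_, ?_⟩
    · linear_combination -(g2 t) - g3 t
    · linear_combination g1 t - g4 t
    · linear_combination b.1 * g3 t + b.2 * g4 t - B' t * hcov
    · linear_combination -a.1 * g3 t - a.2 * g4 t + A' t * hcov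
  · intro h
    have h3 : ∀ t, b.2 * A' t - a.2 * B' t - y' t = b.1 * A t - a.1 * B t := by
      intro t
      obtain ⟨r1, r2, r3, r4⟩ := (key t).1 (h t)
      linear_combination -b.2 * r4 - a.2 * r3 + (y' t + b.1 * A t - a.1 * B t) * hcov
    have h4 : ∀ t, -(b.1 * A' t) + a.1 * B' t + x' t = b.2 * A t - a.2 * B t := by
      intro t
      obtain ⟨r1, r2, r3, r4⟩ := (key t).1 (h t)
      linear_combination a.1 * r3 + b.1 * r4 - (x' t - b.2 * A t + a.2 * B t) * hcov
    refine ⟨fun t => ?_, fun t => ?_, h3, h4⟩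
    · obtain ⟨r1, r2, r3, r4⟩ := (key t).1 (h t)
      linear_combination r2 + h4 t
    · obtain ⟨r1, r2, r3, r4⟩ := (key t).1 (h t)
      linear_combination -r1 - h3 t
end
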